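/- arXiv:2007.13810 — 2 statements merged into one kernel-verified Lean document; each statement's English description precedes it below -/
import Mathlib

section
/- Let (R, m) be a Noetherian local commutative ring and let S be a nonzero module-finite étale R-algebra. Then the structure map R → S splits as a map of R-modules: there exists an R-linear map f : S → R with f(1) = 1; equivalently, the trace ideal τ_{S/R} equals the unit ideal R. -/
universe u

/-- The trace ideal `τ_{S/R}`: the image of the evaluation-at-1 map `Hom_R(S,R) → R`. -/
def traceIdeal (R S : Type*) [CommRing R] [CommRing S] [Algebra R S] : Ideal R :=
  LinearMap.range ((LinearMap.applyₗ (1 : S)) : (S →ₗ[R] R) →ₗ[R] R)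

/-- A nonzero module-finite étale algebra over a Noetherian local ring splits off;
equivalently its trace ideal is the unit ideal. -/
theorem etale_over_local_splits
    (R S : Type u) [CommRing R] [IsNoetherianRing R] [IsLocalRing R]
    [CommRing S] [Nontrivial S] [Algebra R S] [Module.Finite R S]
    [Algebra.Etale R S] :
    (∃ f : S →ₗ[R] R, f 1 = 1) ∧ traceIdeal R S = ⊤ := by
  have key : ∃ f : S →ₗ[R] R, f 1 = 1 := by
    have : Module.Flat R S := inferInstance
    have : Module.Free R S := Module.free_of_flat_of_isLocalRing
    let b := Module.Free.chooseBasis R S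
    by_cases h : ∃ i, IsUnit (b.repr 1 i)
    · obtain ⟨i, u, hu⟩ := h
      refine ⟨(↑u⁻¹ : R) • b.coord i, ?_⟩
      simp [← hu]
    · exfalso
      have h' : ∀ i, b.repr 1 i ∈ IsLocalRing.maximalIdeal R := fun i => by
        rw [IsLocalRing.mem_maximalIdeal]
        exact fun hi => h ⟨i, hi⟩
      have h1 : (1 : S) ∈ (IsLocalRing.maximalIdeal R).map (algebraMap R S) := by
        rw [← b.sum_repr 1]
        refine Ideal.sum_mem _ fun i _ => ?_
        rw [Algebra.smul_def]
        exact Ideal.mul_mem_right _ _ (Ideal.mem_map_of_mem _ (h' i))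
      have h2 := (Ideal.eq_top_iff_one _).2 h1
      have h3 : (⊤ : Submodule R S) ≤ IsLocalRing.maximalIdeal R • (⊤ : Submodule R S) := by
        rw [Ideal.smul_top_eq_map, h2]
        simp
      have h4 := Submodule.eq_bot_of_le_smul_of_le_jacobson_bot (IsLocalRing.maximalIdeal R)
        (⊤ : Submodule R S) Module.Finite.fg_top h3 (IsLocalRing.maximalIdeal_le_jacobson _)
      exact one_ne_zero ((Submodule.mem_bot R).1 (h4 ▸ Submodule.mem_top : (1 : S) ∈ ⊥))
  refine ⟨key, ?_⟩
  obtain ⟨f, hf⟩ := key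
  rw [Ideal.eq_top_iff_one]
  exact ⟨f, hf⟩
end

section
/- Let R be a Noetherian commutative ring, S a module-finite R-algebra, and Q a prime ideal of R such that the localization S_Q is nonzero and is an étale R_Q-algebra. Then the trace ideal τ_{S/R} is not contained in Q. -/
universe u

/-- If `S_Q` is nonzero and étale over `R_Q`, then the trace ideal `τ_{S/R}` is not
contained in the prime `Q`. -/
theorem trace_ideal_not_le_prime_of_etale
    (R S : Type u) [CommRing R] [IsNoetherianRing R] [CommRing S] [Algebra R S]
    [Module.Finite R S] (Q : Ideal R) [Q.IsPrime]
    (Rₚ Sₚ : Type u) [CommRing Rₚ] [CommRing Sₚ]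
    [Algebra R Rₚ] [IsLocalization.AtPrime Rₚ Q]
    [Algebra S Sₚ] [IsLocalization (Algebra.algebraMapSubmonoid S Q.primeCompl) Sₚ]
    [Algebra Rₚ Sₚ] [Algebra R Sₚ] [IsScalarTower R Rₚ Sₚ] [IsScalarTower R S Sₚ]
    [Nontrivial Sₚ] [Algebra.Etale Rₚ Sₚ] :
    ¬ traceIdeal R S ≤ Q := by
  intro hle
  have hloc : IsLocalRing Rₚ := IsLocalization.AtPrime.isLocalRing Rₚ Q
  have hfin : Module.Finite Rₚ Sₚ := Module.Finite.of_isLocalization R S Q.primeCompl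
  have hflat : Module.Flat Rₚ Sₚ := inferInstance
  have hfree : Module.Free Rₚ Sₚ := Module.free_of_flat_of_isLocalRing
  let b := Module.Free.chooseBasis Rₚ Sₚ
  have h1 : ∃ i, IsUnit (b.repr 1 i) := by
    by_contra! hcon
    have hmem : (1 : Sₚ) ∈ (IsLocalRing.maximalIdeal Rₚ).map (algebraMap Rₚ Sₚ) := by
      rw [← b.sum_repr 1]
      refine Ideal.sum_mem _ fun i _ => ?_
      rw [Algebra.smul_def]
      exact Ideal.mul_mem_right _ _ (Ideal.mem_map_of_mem _
        ((IsLocalRing.mem_maximalIdeal _).2 (hcon i)))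
    have htop : (IsLocalRing.maximalIdeal Rₚ) • (⊤ : Submodule Rₚ Sₚ) = ⊤ := by
      rw [Ideal.smul_top_eq_map, (Ideal.eq_top_iff_one _).2 hmem]
      rfl
    have hbot : (⊤ : Submodule Rₚ Sₚ) = ⊥ :=
      Submodule.eq_bot_of_le_smul_of_le_jacobson_bot (IsLocalRing.maximalIdeal Rₚ) ⊤
        Module.Finite.fg_top htop.ge (IsLocalRing.maximalIdeal_le_jacobson _)
    exact top_ne_bot hbot
  obtain ⟨i, hi⟩ := h1
  let g : S →ₗ[R] Rₚ :=
    ((b.coord i).restrictScalars R).comp (IsScalarTower.toAlgHom R S Sₚ).toLinearMap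
  haveI : Module.FinitePresentation R S := Module.finitePresentation_of_finite R S
  obtain ⟨h, s, hs⟩ := Module.FinitePresentation.exists_lift_of_isLocalizedModule
    Q.primeCompl (Algebra.linearMap R Rₚ) g
  have hh := LinearMap.congr_fun hs (1 : S)
  have hu : IsUnit (algebraMap R Rₚ (h 1)) := by
    have : algebraMap R Rₚ (h 1) = algebraMap R Rₚ s * b.repr 1 i := by
      simpa [g, Submonoid.smul_def, Algebra.smul_def] using hh
    rw [this]
    exact (IsLocalization.map_units Rₚ s).mul hi
  exact (IsLocalization.AtPrime.isUnit_to_map_iff Rₚ Q (h 1)).1 hu (hle ⟨h, rfl⟩)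
end
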